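/- A closed set X ⊆ ℝⁿ satisfies the property that at every boundary point x ∈ ∂X there exist closed r-balls B ⊆ X and B′ ⊆ closure(Xᶜ) with B ∩ B′ = {x}, if and only if both X and closure(Xᶜ) are unions of closed r-balls. -/

import Mathlib

open Metric

theorem aux_fwd {E : Type*} [NormedAddCommGroup E] [InnerProductSpace ℝ E] [ProperSpace E]
    (r : ℝ) (hr : 0 < r) (A : Set E) (hA : IsClosed A)
    (h : ∀ y ∈ frontier A, ∃ xb xw : E, closedBall xb r ⊆ A ∧
      Disjoint (interior A) (ball xw r) ∧ closedBall xb r ∩ closedBall xw r = {y})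
    (x : E) (hx : x ∈ A) : ∃ c, x ∈ closedBall c r ∧ closedBall c r ⊆ A := by
  by_cases hb : ball x r ⊆ A
  · refine ⟨x, mem_closedBall_self hr.le, ?_⟩
    rw [← closure_ball x hr.ne']
    exact closure_minimal hb hA
  obtain ⟨z, hz, hzA⟩ := Set.not_subset.1 hb
  have hzc : z ∈ closure Aᶜ := subset_closure hzA
  obtain ⟨y, hy, hxy⟩ := isClosed_closure.exists_infDist_eq_dist ⟨z, hzc⟩ x
  have hdr : dist x y < r := by
    rw [← hxy]
    refine lt_of_le_of_lt (infDist_le_dist_of_mem hzc) ?_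
    rw [dist_comm]; exact hz
  have hball : ball x (dist x y) ⊆ interior A := by
    intro w hw
    by_contra hwi
    have hw2 : w ∈ closure Aᶜ := by rw [closure_compl]; exact hwi
    have h1 := infDist_le_dist_of_mem (x := x) hw2
    rw [mem_ball, dist_comm] at hw
    linarith
  rcases eq_or_ne x y with rfl | hne
  · have hfr : x ∈ frontier A := by
      rw [frontier_eq_closure_inter_closure]
      exact ⟨subset_closure hx, hy⟩
    obtain ⟨xb, xw, h1, -, h3⟩ := h x hfr
    have : x ∈ closedBall xb r ∩ closedBall xw r := by rw [h3]; rfl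
    exact ⟨xb, this.1, h1⟩
  have hd : 0 < dist x y := dist_pos.2 hne
  have hyA : y ∈ A := by
    have h1 : closedBall x (dist x y) ⊆ A := by
      rw [← closure_ball x hd.ne']
      exact closure_minimal (hball.trans interior_subset) hA
    exact h1 (by rw [mem_closedBall, dist_comm])
  have hfr : y ∈ frontier A := by
    rw [frontier_eq_closure_inter_closure]
    exact ⟨subset_closure hyA, hy⟩
  obtain ⟨xb, xw, h1, h2, h3⟩ := h y hfr
  refine ⟨xb, ?_, h1⟩
  have hyy : y ∈ closedBall xb r ∩ closedBall xw r := by rw [h3]; rfl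
  have hbw : dist xb xw ≤ 2 * r := by
    have := dist_triangle xb y xw
    have h4 := hyy.1
    have h5 := hyy.2
    rw [mem_closedBall] at h4 h5
    rw [dist_comm] at h4
    linarith
  have hm : midpoint ℝ xb xw = y := by
    have : midpoint ℝ xb xw ∈ closedBall xb r ∩ closedBall xw r := by
      constructor
      · rw [mem_closedBall, dist_midpoint_left]; norm_num; linarith
      · rw [mem_closedBall, dist_midpoint_right]; norm_num; linarith
    rw [h3] at this
    exact this
  have hdist : dist x y + r ≤ dist x xw :=
    (disjoint_ball_ball_iff hd hr).1 (h2.mono_left hball)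
  obtain ⟨v, rfl⟩ : ∃ v, xw = y - v := ⟨y - xw, by abel⟩
  have hxb : xb = y + v := by
    have h6 : xb + (y - v) = y + y := by
      have h7 := midpoint_add_self ℝ xb (y - v)
      rw [hm] at h7
      exact h7.symm
    have : xb = (xb + (y - v)) - (y - v) := by abel
    rw [this, h6]; abel
  subst hxb
  obtain ⟨a, rfl⟩ : ∃ a, x = y + a := ⟨x - y, by abel⟩
  have hv : ‖v‖ ≤ r := by
    have := hyy.2
    simpa [mem_closedBall, dist_eq_norm] using this
  have e1 : dist (y + a) y = ‖a‖ := by simp [dist_eq_norm]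
  have e2 : dist (y + a) (y - v) = ‖a + v‖ := by rw [dist_eq_norm]; congr 1; abel
  have e3 : dist (y + a) (y + v) = ‖a - v‖ := by rw [dist_eq_norm]; congr 1; abel
  rw [e1, e2] at hdist
  rw [e1] at hdr
  rw [mem_closedBall, e3]
  have p1 := norm_add_sq_real a v
  have p2 := norm_sub_sq_real a v
  have ha := norm_nonneg a
  have hv0 := norm_nonneg v
  have q1 : (‖a‖ + r) ^ 2 ≤ ‖a + v‖ ^ 2 := by gcongr
  have q2 : ‖v‖ ^ 2 ≤ r ^ 2 := by gcongr
  have q3 : ‖a - v‖ ^ 2 ≤ r ^ 2 := by nlinarith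
  exact (sq_le_sq₀ (norm_nonneg _) hr.le).1 q3

/-- A closed set `X ⊆ ℝⁿ` has at every boundary point `x` two closed `r`-balls
`B ⊆ X` and `B' ⊆ closure Xᶜ` with `B ∩ B' = {x}`, if and only if both `X` and
`closure Xᶜ` are unions of closed `r`-balls. -/
theorem stmt4 (n : ℕ) (r : ℝ) (hr : 0 < r) (X : Set (EuclideanSpace ℝ (Fin n)))
    (hX : IsClosed X) :
    (∀ x ∈ frontier X, ∃ xb xw : EuclideanSpace ℝ (Fin n),
        closedBall xb r ⊆ X ∧ closedBall xw r ⊆ closure Xᶜ ∧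
        closedBall xb r ∩ closedBall xw r = {x}) ↔
    ((∀ x ∈ X, ∃ c, x ∈ closedBall c r ∧ closedBall c r ⊆ X) ∧
     (∀ x ∈ closure Xᶜ, ∃ c, x ∈ closedBall c r ∧ closedBall c r ⊆ closure Xᶜ)) := by
  constructor
  · intro h
    refine ⟨fun x hx => aux_fwd r hr X hX ?_ x hx,
      fun x hx => aux_fwd r hr (closure Xᶜ) isClosed_closure ?_ x hx⟩
    · intro y hy
      obtain ⟨xb, xw, h1, h2, h3⟩ := h y hy
      refine ⟨xb, xw, h1, ?_, h3⟩
      rw [closure_compl] at h2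
      exact Set.disjoint_left.2 fun w hw hw' => h2 (ball_subset_closedBall hw') hw
    · intro y hy
      have hy' : y ∈ frontier X := by
        rw [← frontier_compl]; exact frontier_closure_subset hy
      obtain ⟨xb, xw, h1, h2, h3⟩ := h y hy'
      refine ⟨xw, xb, h2, ?_, by rw [Set.inter_comm]; exact h3⟩
      have h4 : ball xb r ⊆ interior X :=
        interior_maximal (ball_subset_closedBall.trans h1) isOpen_ball
      refine Set.disjoint_left.2 fun w hw hw' => ?_
      have := interior_subset hw
      rw [closure_compl] at this
      exact this (h4 hw')
  · rintro ⟨h1, h2⟩ x hx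
    rw [frontier_eq_closure_inter_closure, hX.closure_eq] at hx
    obtain ⟨b, hxb, hb⟩ := h1 x hx.1
    obtain ⟨w, hxw, hw⟩ := h2 x hx.2
    refine ⟨b, w, hb, hw, ?_⟩
    have hdisj : Disjoint (ball b r) (ball w r) := by
      refine Set.disjoint_left.2 fun z hz hz' => ?_
      have h4 : ball b r ⊆ interior X :=
        interior_maximal (ball_subset_closedBall.trans hb) isOpen_ball
      have := hw (ball_subset_closedBall hz')
      rw [closure_compl] at this
      exact this (h4 hz)
    have hd := (disjoint_ball_ball_iff hr hr).1 hdisj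
    have key : ∀ z ∈ closedBall b r ∩ closedBall w r, z = midpoint ℝ b w := by
      rintro z ⟨hz1, hz2⟩
      rw [mem_closedBall] at hz1 hz2
      have ht := dist_triangle b z w
      rw [dist_comm] at hz1
      apply eq_midpoint_of_dist_eq_half <;> linarith
    ext z
    constructor
    · intro hz
      exact (key z hz).trans (key x ⟨hxb, hxw⟩).symm
    · rintro rfl
      exact ⟨hxb, hxw⟩
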